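/- arXiv:2308.10014 — 2 statements merged into one kernel-verified Lean document; each statement's English description precedes it below -/
import Mathlib

section
/- (Error bound under ε-accurate network approximation.) Let Ω be a set and ε ≥ 0. For each φ ∈ Ω let μ_φ be a probability measure on ℝ^d, let G_φ : ℝ^d → ℝ^d be measurable with ∫‖G_φ‖² dμ_φ < ∞, and let f_φ : ℝ^d → ℝ^d be measurable such that the residual R_φ := G_φ − f_φ satisfies ∫‖R_φ(x)‖² dμ_φ(x) ≤ ε (ε-accuracy). Define D(φ) = ∫‖G_φ‖² dμ_φ and J(φ) = ∫ [2⟨f_φ(x), G_φ(x)⟩ − ‖f_φ(x)‖²] dμ_φ(x). If φ̃ ∈ Ω minimizes J over Ω and φ* ∈ Ω minimizes D over Ω, then D(φ̃) ≤ D(φ*) + ε. -/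
open MeasureTheory
open scoped RealInnerProductSpace

theorem two_inner_sub_norm_sq_eq {E : Type*} [NormedAddCommGroup E] [InnerProductSpace ℝ E]
    (u v : E) : 2 * ⟪u, v⟫ - ‖u‖ ^ 2 = ‖v‖ ^ 2 - ‖v - u‖ ^ 2 := by
  rw [norm_sub_sq_real, real_inner_comm]
  ring

theorem integral_two_inner_sub_norm_sq {α E : Type*} [MeasurableSpace α]
    [NormedAddCommGroup E] [InnerProductSpace ℝ E] {μ : Measure α} {f g : α → E}
    (hg : Integrable (fun x => ‖g x‖ ^ 2) μ) (hr : Integrable (fun x => ‖g x - f x‖ ^ 2) μ) :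
    ∫ x, (2 * ⟪f x, g x⟫ - ‖f x‖ ^ 2) ∂μ
      = ∫ x, ‖g x‖ ^ 2 ∂μ - ∫ x, ‖g x - f x‖ ^ 2 ∂μ := by
  simp only [two_inner_sub_norm_sq_eq]
  exact integral_sub hg hr

/-- Error bound under `ε`-accurate network approximation (Proposition 1): if for each
`φ ∈ Ω` the residual `R_φ = G_φ − f_φ` satisfies `∫ ‖R_φ‖² dμ_φ ≤ ε`, and `φ̃`
minimizes the surrogate objective `J(φ) = ∫ [2⟨f_φ, G_φ⟩ − ‖f_φ‖²] dμ_φ` while `φ*`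
minimizes `D(φ) = ∫ ‖G_φ‖² dμ_φ`, then `D(φ̃) ≤ D(φ*) + ε`. -/
theorem stmt_9 {d : ℕ} {Ω : Type*} (ε : ℝ) (hε : 0 ≤ ε)
    (μ : Ω → Measure (EuclideanSpace ℝ (Fin d)))
    (hμ : ∀ φ, IsProbabilityMeasure (μ φ))
    (G f : Ω → EuclideanSpace ℝ (Fin d) → EuclideanSpace ℝ (Fin d))
    (hGmeas : ∀ φ, Measurable (G φ))
    (hfmeas : ∀ φ, Measurable (f φ))
    (hGL2 : ∀ φ, Integrable (fun x => ‖G φ x‖ ^ 2) (μ φ))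
    (hResInt : ∀ φ, Integrable (fun x => ‖G φ x - f φ x‖ ^ 2) (μ φ))
    (hRes : ∀ φ, (∫ x, ‖G φ x - f φ x‖ ^ 2 ∂(μ φ)) ≤ ε)
    (φtilde φstar : Ω)
    (hφtilde : ∀ φ : Ω,
      (∫ x, (2 * ⟪f φtilde x, G φtilde x⟫ - ‖f φtilde x‖ ^ 2) ∂(μ φtilde))
        ≤ ∫ x, (2 * ⟪f φ x, G φ x⟫ - ‖f φ x‖ ^ 2) ∂(μ φ))
    (hφstar : ∀ φ : Ω,
      (∫ x, ‖G φstar x‖ ^ 2 ∂(μ φstar)) ≤ ∫ x, ‖G φ x‖ ^ 2 ∂(μ φ)) :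
    (∫ x, ‖G φtilde x‖ ^ 2 ∂(μ φtilde)) ≤ (∫ x, ‖G φstar x‖ ^ 2 ∂(μ φstar)) + ε := by
  have hJ := hφtilde φstar
  rw [integral_two_inner_sub_norm_sq (hGL2 φtilde) (hResInt φtilde),
    integral_two_inner_sub_norm_sq (hGL2 φstar) (hResInt φstar)] at hJ
  have hpos : 0 ≤ ∫ x, ‖G φstar x - f φstar x‖ ^ 2 ∂(μ φstar) :=
    integral_nonneg fun x => sq_nonneg _
  linarith [hRes φtilde]
end

section
/- Let q and p be strictly positive differentiable probability densities on ℝ^d with scores s_q = ∇log q and s_p = ∇log p, and assume ∫ q(x)‖s_p(x) − s_q(x)‖² dx < ∞. Let F be a class of differentiable vector fields f : ℝ^d → ℝ^d, each square-integrable with respect to q, such that every f ∈ F satisfies Stein's identity ∫ q(x)[⟨s_q(x), f(x)⟩ + tr(Df(x))] dx = 0 (where Df(x) is the Jacobian of f at x), and such that s_p − s_q ∈ F. Then for every f ∈ F, ∫ q(x)[⟨s_p(x), f(x)⟩ + tr(Df(x)) − (1/2)‖f(x)‖²] dx = ∫ q(x)[⟨f(x), s_p(x) − s_q(x)⟩ −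 (1/2)‖f(x)‖²] dx ≤ (1/2)∫ q(x)‖s_p(x) − s_q(x)‖² dx, and sup over f ∈ F of ∫ q(x)[⟨s_p(x), f(x)⟩ + tr(Df(x)) − (1/2)‖f(x)‖²] dx = (1/2)∫ q(x)‖s_p(x) − s_q(x)‖² dx, attained at f = s_p − s_q. -/
open MeasureTheory
open scoped RealInnerProductSpace

/-- A weighted inner product of two continuous, weighted square-integrable vector fields is
integrable. -/
lemma integrable_mul_inner_of_integrable_mul_norm_sq {E : Type*} [NormedAddCommGroup E]
    [InnerProductSpace ℝ E] [SecondCountableTopology E] [MeasurableSpace E] [BorelSpace E]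
    {μ : Measure E} {q : E → ℝ} {f g : E → E} (hq : Continuous q) (hf : Continuous f)
    (hg : Continuous g) (hqpos : ∀ x, 0 ≤ q x) (hf2 : Integrable (fun x => q x * ‖f x‖ ^ 2) μ)
    (hg2 : Integrable (fun x => q x * ‖g x‖ ^ 2) μ) :
    Integrable (fun x => q x * ⟪f x, g x⟫) μ := by
  refine (hf2.add hg2).mono' (hq.mul (hf.inner hg)).aestronglyMeasurable (.of_forall fun x => ?_)
  rw [norm_mul, Real.norm_of_nonneg (hqpos x), Pi.add_apply, ← mul_add]
  refine mul_le_mul_of_nonneg_left ((norm_inner_le_norm _ _).trans ?_) (hqpos x)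
  nlinarith [sq_nonneg (‖f x‖ - ‖g x‖), sq_nonneg ‖f x‖, sq_nonneg ‖g x‖]

/-- Young's inequality for the inner product, completing the square. -/
lemma inner_sub_half_norm_sq_le {E : Type*} [NormedAddCommGroup E] [InnerProductSpace ℝ E]
    (u v : E) : ⟪u, v⟫ - (1 / 2) * ‖u‖ ^ 2 ≤ (1 / 2) * ‖v‖ ^ 2 := by
  nlinarith [norm_sub_sq_real u v, sq_nonneg ‖u - v‖]

/-- Learned Stein discrepancy with `L²` regularization weight `λ = 1/2`: for strictly
positive differentiable probability densities `q, p` on `ℝ^d` with scores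
`s_q = ∇log q`, `s_p = ∇log p`, and a class `F` of differentiable, `q`-square-
integrable vector fields satisfying Stein's identity and containing `s_p − s_q`, the
objective `∫ q[⟨s_p, f⟩ + tr(Df) − ½‖f‖²]` equals `∫ q[⟨f, s_p − s_q⟩ − ½‖f‖²]`, is
bounded by half the Fisher divergence `½∫ q‖s_p − s_q‖²`, and its supremum over `F`
equals half the Fisher divergence, attained at `f = s_p − s_q`. -/
theorem stmt_10 {d : ℕ}
    (q p : EuclideanSpace ℝ (Fin d) → ℝ)
    (hqpos : ∀ x, 0 < q x) (hppos : ∀ x, 0 < p x)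
    (hqdiff : Differentiable ℝ q) (hpdiff : Differentiable ℝ p)
    (hqdens : ∫ x, q x = 1) (hpdens : ∫ x, p x = 1)
    (hFisher : Integrable (fun x =>
      q x * ‖gradient (fun y => Real.log (p y)) x
        - gradient (fun y => Real.log (q y)) x‖ ^ 2))
    (F : Set (EuclideanSpace ℝ (Fin d) → EuclideanSpace ℝ (Fin d)))
    (hFdiff : ∀ f ∈ F, Differentiable ℝ f)
    (hFL2 : ∀ f ∈ F, Integrable (fun x => q x * ‖f x‖ ^ 2))
    (hFSteinInt : ∀ f ∈ F, Integrable (fun x =>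
      q x * (⟪gradient (fun y => Real.log (q y)) x, f x⟫
        + LinearMap.trace ℝ (EuclideanSpace ℝ (Fin d))
            (fderiv ℝ f x : EuclideanSpace ℝ (Fin d) →ₗ[ℝ] EuclideanSpace ℝ (Fin d)))))
    (hStein : ∀ f ∈ F,
      ∫ x, q x * (⟪gradient (fun y => Real.log (q y)) x, f x⟫
        + LinearMap.trace ℝ (EuclideanSpace ℝ (Fin d))
            (fderiv ℝ f x : EuclideanSpace ℝ (Fin d) →ₗ[ℝ] EuclideanSpace ℝ (Fin d))) = 0)
    (hmem : (fun x => gradient (fun y => Real.log (p y)) x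
        - gradient (fun y => Real.log (q y)) x) ∈ F) :
    (∀ f ∈ F,
      (∫ x, q x * (⟪gradient (fun y => Real.log (p y)) x, f x⟫
          + LinearMap.trace ℝ (EuclideanSpace ℝ (Fin d))
              (fderiv ℝ f x : EuclideanSpace ℝ (Fin d) →ₗ[ℝ] EuclideanSpace ℝ (Fin d))
          - (1 / 2) * ‖f x‖ ^ 2)
        = ∫ x, q x * (⟪f x, gradient (fun y => Real.log (p y)) x
            - gradient (fun y => Real.log (q y)) x⟫ - (1 / 2) * ‖f x‖ ^ 2)) ∧
      (∫ x, q x * (⟪f x, gradient (fun y => Real.log (p y)) x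
          - gradient (fun y => Real.log (q y)) x⟫ - (1 / 2) * ‖f x‖ ^ 2))
        ≤ (1 / 2) * ∫ x, q x * ‖gradient (fun y => Real.log (p y)) x
            - gradient (fun y => Real.log (q y)) x‖ ^ 2) ∧
    IsGreatest {r : ℝ | ∃ f ∈ F,
        r = ∫ x, q x * (⟪gradient (fun y => Real.log (p y)) x, f x⟫
          + LinearMap.trace ℝ (EuclideanSpace ℝ (Fin d))
              (fderiv ℝ f x : EuclideanSpace ℝ (Fin d) →ₗ[ℝ] EuclideanSpace ℝ (Fin d))
          - (1 / 2) * ‖f x‖ ^ 2)}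
      ((1 / 2) * ∫ x, q x * ‖gradient (fun y => Real.log (p y)) x
          - gradient (fun y => Real.log (q y)) x‖ ^ 2) := by
  set sp := gradient (fun y => Real.log (p y))
  set sq := gradient (fun y => Real.log (q y))
  have hcross : ∀ f ∈ F, Integrable (fun x =>
      q x * (⟪f x, sp x - sq x⟫ - (1 / 2) * ‖f x‖ ^ 2)) := fun f hf => by
    have h := integrable_mul_inner_of_integrable_mul_norm_sq hqdiff.continuous
      (hFdiff f hf).continuous (hFdiff _ hmem).continuous (fun x => (hqpos x).le)
      (hFL2 f hf) hFisher
    refine (h.sub ((hFL2 f hf).const_mul (1 / 2))).congr (.of_forall fun x => ?_)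
    simp only [Pi.sub_apply]
    ring
  have heq : ∀ f ∈ F,
      (∫ x, q x * (⟪sp x, f x⟫
          + LinearMap.trace ℝ (EuclideanSpace ℝ (Fin d))
              (fderiv ℝ f x : EuclideanSpace ℝ (Fin d) →ₗ[ℝ] EuclideanSpace ℝ (Fin d))
          - (1 / 2) * ‖f x‖ ^ 2))
        = ∫ x, q x * (⟪f x, sp x - sq x⟫ - (1 / 2) * ‖f x‖ ^ 2) := fun f hf => by
    rw [← zero_add (∫ x, q x * (⟪f x, sp x - sq x⟫ - (1 / 2) * ‖f x‖ ^ 2)), ← hStein f hf,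
      ← integral_add (hFSteinInt f hf) (hcross f hf)]
    refine integral_congr_ae (.of_forall fun x => ?_)
    simp only [inner_sub_right, real_inner_comm (f x)]
    ring
  have hle : ∀ f ∈ F, (∫ x, q x * (⟪f x, sp x - sq x⟫ - (1 / 2) * ‖f x‖ ^ 2))
      ≤ (1 / 2) * ∫ x, q x * ‖sp x - sq x‖ ^ 2 := fun f hf => by
    rw [← integral_const_mul]
    refine integral_mono (hcross f hf) (hFisher.const_mul _) fun x => ?_
    rw [mul_left_comm]
    exact mul_le_mul_of_nonneg_left (inner_sub_half_norm_sq_le _ _) (hqpos x).le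
  refine ⟨fun f hf => ⟨heq f hf, hle f hf⟩, ⟨_, hmem, ?_⟩, ?_⟩
  · rw [heq _ hmem, ← integral_const_mul]
    refine integral_congr_ae (.of_forall fun x => ?_)
    simp only [real_inner_self_eq_norm_sq]
    ring
  · rintro _ ⟨f, hf, rfl⟩
    exact (heq f hf).trans_le (hle f hf)
end
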